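/- arXiv:2603.15316 — 2 statements merged into one kernel-verified Lean document; each statement's English description precedes it below -/
import Mathlib

section
/- Let ν = (a,b) ∈ ℝ^n × ℝ^{nm} be a nonzero vector and let G_ν = −Δ_{x'} − |x'|² Δ_{x''} − 2 a·∇_{x'} − 2 Σ_{j=1}^n Σ_{k=1}^m b_{j,k} x'_j ∂_{x''_k} acting on C_c^∞(ℝ^{n+m}). Let μ be a nonzero, locally finite, positive Borel measure on ℝ^{n+m}. Then ∫_{ℝ^{n+m}} (G_ν f) g dμ = ∫_{ℝ^{n+m}} f (G_ν g) dμ holds for all real-valued f, g ∈ C_c^∞(ℝ^{n+m}) if and only if b = 0 and there exists a constant c > 0 such that dμ = c e^{2a·x'} dx. -/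
noncomputable section
open MeasureTheory Real Set

/-- `ℝ^{n+m}` written as pairs `x = (x', x'')`. -/
abbrev Ep (n m : ℕ) := EuclideanSpace ℝ (Fin n) × EuclideanSpace ℝ (Fin m)

/-- Euclidean dot product. -/
def dotp {n : ℕ} (a b : EuclideanSpace ℝ (Fin n)) : ℝ := ∑ i, a i * b i

/-- `∂_{x'_j}`. -/
def pdFst {n m : ℕ} (j : Fin n) (f : Ep n m → ℝ) (x : Ep n m) : ℝ :=
  deriv (fun s : ℝ => f (x.1 + s • EuclideanSpace.single j 1, x.2)) 0

/-- `∂_{x''_k}`. -/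
def pdSnd {n m : ℕ} (k : Fin m) (f : Ep n m → ℝ) (x : Ep n m) : ℝ :=
  deriv (fun s : ℝ => f (x.1, x.2 + s • EuclideanSpace.single k 1)) 0

/-- The Grushin operator with drift `ν = (a,b)`:
`G_ν = -Δ_{x'} - |x'|² Δ_{x''} - 2 a·∇_{x'} - 2 Σ_{j,k} b_{j,k} x'_j ∂_{x''_k}`. -/
def Gdrift {n m : ℕ} (a : EuclideanSpace ℝ (Fin n)) (b : Fin n → Fin m → ℝ)
    (f : Ep n m → ℝ) (x : Ep n m) : ℝ :=
  -(∑ j, pdFst j (pdFst j f) x) - ‖x.1‖ ^ 2 * ∑ k, pdSnd k (pdSnd k f) x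
    - 2 * ∑ j, a j * pdFst j f x
    - 2 * ∑ j, ∑ k, b j k * (x.1 j * pdSnd k f x)

section helpers

set_option linter.unusedSectionVars false
open Pointwise

variable {E : Type*} [NormedAddCommGroup E] [NormedSpace ℝ E] [FiniteDimensional ℝ E]
  [MeasurableSpace E] [BorelSpace E]

lemma measure_eq_of_smooth (μ ν : Measure E) [IsLocallyFiniteMeasure μ] [IsLocallyFiniteMeasure ν]
    (h : ∀ g : E → ℝ, ContDiff ℝ (⊤ : ℕ∞) g → HasCompactSupport g → ∫ x, g x ∂μ = ∫ x, g x ∂ν) :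
    μ = ν := by
  have : ProperSpace E := FiniteDimensional.proper ℝ E
  have h1 : μ ≪ μ + ν := Measure.absolutelyContinuous_of_le (Measure.le_add_right le_rfl)
  have h2 : ν ≪ μ + ν := Measure.absolutelyContinuous_of_le (Measure.le_add_left le_rfl)
  have key : ∀ᵐ x ∂(μ + ν), (μ.rnDeriv (μ + ν) x).toReal = (ν.rnDeriv (μ + ν) x).toReal := by
    refine ae_eq_of_integral_contDiff_smul_eq ?_ ?_ ?_
    · rw [locallyIntegrable_iff]
      intro K hK
      exact Measure.integrableOn_toReal_rnDeriv hK.measure_lt_top.ne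
    · rw [locallyIntegrable_iff]
      intro K hK
      exact Measure.integrableOn_toReal_rnDeriv hK.measure_lt_top.ne
    · intro g hg hc
      have e1 := integral_rnDeriv_smul h1 (f := g)
      have e2 := integral_rnDeriv_smul h2 (f := g)
      simp only [smul_eq_mul] at *
      simp_rw [mul_comm (g _)]
      rw [e1, e2]
      exact h g hg hc
  refine (Measure.withDensity_rnDeriv_eq _ _ h1).symm.trans
    (Eq.trans ?_ (Measure.withDensity_rnDeriv_eq _ _ h2))
  apply withDensity_congr_ae
  filter_upwards [key, μ.rnDeriv_lt_top (μ + ν), ν.rnDeriv_lt_top (μ + ν)] with x hx a1 a2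
  exact (ENNReal.toReal_eq_toReal_iff' a1.ne a2.ne).1 hx

lemma integrable_ccs (μ : Measure E) [IsLocallyFiniteMeasure μ] {f : E → ℝ}
    (hf : Continuous f) (hc : HasCompactSupport f) : Integrable f μ :=
  hf.integrable_of_hasCompactSupport hc

lemma hcs_D {f : E → ℝ} (hc : HasCompactSupport f) (v : E) :
    HasCompactSupport (fun x => fderiv ℝ f x v) := hc.fderiv_apply (𝕜 := ℝ) v

lemma cd_D {f : E → ℝ} (hf : ContDiff ℝ (⊤ : ℕ∞) f) (v : E) :
    ContDiff ℝ (⊤ : ℕ∞) (fun x => fderiv ℝ f x v) :=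
  (hf.fderiv_right (m := (⊤ : ℕ∞)) (by simp)).clm_apply contDiff_const

/-- A locally finite measure annihilating all derivatives is translation invariant. -/
lemma invariant_of_deriv (μ : Measure E) [IsLocallyFiniteMeasure μ]
    (h : ∀ g : E → ℝ, ContDiff ℝ (⊤ : ℕ∞) g → HasCompactSupport g →
      ∀ v, ∫ x, fderiv ℝ g x v ∂μ = 0) :
    Measure.IsAddLeftInvariant μ := by
  have : ProperSpace E := FiniteDimensional.proper ℝ E
  refine ⟨fun w => ?_⟩
  have hfc : IsFiniteMeasureOnCompacts (Measure.map (fun x => w + x) μ) :=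
    Measure.IsFiniteMeasureOnCompacts.map μ (Homeomorph.addLeft w)
  have : IsLocallyFiniteMeasure (Measure.map (fun x => w + x) μ) :=
    isLocallyFiniteMeasure_of_isFiniteMeasureOnCompacts
  apply measure_eq_of_smooth
  intro g hg hc
  have e0 : ∫ x, g x ∂(Measure.map (fun x => w + x) μ) = ∫ x, g (w + x) ∂μ :=
    (Homeomorph.addLeft w).measurableEmbedding.integral_map (g := g)
  rw [e0]
  have hD : ∀ t : ℝ, HasDerivAt (fun t : ℝ => ∫ x, g (t • w + x) ∂μ) 0 t := by
    intro t
    have hD0 : ∫ x, fderiv ℝ g (t • w + x) w ∂μ = 0 := by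
      have := h (fun x => g (t • w + x)) (hg.comp (contDiff_const.add contDiff_id))
        (hc.comp_homeomorph (Homeomorph.addLeft (t • w))) w
      simpa [fderiv_comp_add_left] using this
    have hcD := hcs_D hc w
    have hgD := (cd_D hg w).continuous
    obtain ⟨C, hC⟩ := hcD.exists_bound_of_continuous hgD
    let K : Set E := tsupport (fun x => fderiv ℝ g x w) + Metric.closedBall 0 ((|t| + 1) * ‖w‖)
    have hK : IsCompact K := hcD.isCompact.add (isCompact_closedBall _ _)
    have hsup : ∀ (s : ℝ) (x : E), s ∈ Metric.ball t 1 → x ∉ K → fderiv ℝ g (s • w + x) w = 0 := by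
      intro s x hs hx
      by_contra hne
      apply hx
      refine ⟨s • w + x, subset_tsupport _ hne, -(s • w), ?_, by simp⟩
      rw [mem_closedBall_zero_iff, norm_neg, norm_smul]
      gcongr
      rw [Metric.mem_ball, Real.dist_eq] at hs
      have := abs_sub_abs_le_abs_sub s t
      rw [Real.norm_eq_abs]; linarith
    have := hasDerivAt_integral_of_dominated_loc_of_deriv_le (μ := μ) (x₀ := t) (s := Metric.ball t 1)
      (F := fun t x => g (t • w + x)) (F' := fun t x => fderiv ℝ g (t • w + x) w)
      (bound := K.indicator fun _ => C) (Metric.ball_mem_nhds _ one_pos)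
      (Filter.Eventually.of_forall fun s => by
        have := hg.continuous
        exact (by fun_prop : Continuous fun x => g (s • w + x)).aestronglyMeasurable)
      ((by have := hg.continuous; fun_prop : Continuous fun x => g (t • w + x)).integrable_of_hasCompactSupport
        (hc.comp_homeomorph (Homeomorph.addLeft (t • w))))
      (hgD.comp (by fun_prop : Continuous fun x => t • w + x)).aestronglyMeasurable
      (Filter.Eventually.of_forall fun x s hs => by
        by_cases hx : x ∈ K
        · rw [indicator_of_mem hx]; exact hC _
        · rw [indicator_of_notMem hx, hsup s x hs hx, norm_zero])
      ((integrable_indicator_iff hK.measurableSet).2 (integrableOn_const hK.measure_lt_top.ne))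
      (Filter.Eventually.of_forall fun x s hs => by
        have h1 : HasDerivAt (fun s : ℝ => s • w + x) w s := by
          simpa using ((hasDerivAt_id s).smul_const w).add_const x
        exact ((hg.differentiable (by simp)) (s • w + x)).hasFDerivAt.comp_hasDerivAt s h1)
    rw [hD0] at this
    exact this.2
  have := is_const_of_deriv_eq_zero (fun t => (hD t).differentiableAt) (fun t => (hD t).deriv) 1 0
  simpa using this

/-- A nonzero locally finite measure annihilating all derivatives is a multiple of Haar. -/
lemma eq_smul_of_deriv (μ ν : Measure E) [IsLocallyFiniteMeasure μ] [ν.IsAddHaarMeasure] (hμ : μ ≠ 0)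
    (h : ∀ g : E → ℝ, ContDiff ℝ (⊤ : ℕ∞) g → HasCompactSupport g →
      ∀ v, ∫ x, fderiv ℝ g x v ∂μ = 0) :
    ∃ c : ℝ, 0 < c ∧ μ = ENNReal.ofReal c • ν := by
  have : ProperSpace E := FiniteDimensional.proper ℝ E
  have := invariant_of_deriv μ h
  have h1 := Measure.isAddLeftInvariant_eq_smul μ ν
  refine ⟨(μ.addHaarScalarFactor ν : ℝ), ?_, ?_⟩
  · rcases eq_or_lt_of_le (μ.addHaarScalarFactor ν).2 with h0 | h0
    · exfalso; apply hμ; rw [h1]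
      have : μ.addHaarScalarFactor ν = 0 := by ext; exact h0.symm
      rw [this, zero_smul]
    · exact h0
  · rw [ENNReal.ofReal_coe_nnreal]; exact h1

/-- Integral of a derivative against Haar measure vanishes. -/
lemma integral_D (ν : Measure E) [ν.IsAddHaarMeasure] {g : E → ℝ}
    (hg : ContDiff ℝ (⊤ : ℕ∞) g) (hc : HasCompactSupport g) (v : E) :
    ∫ x, fderiv ℝ g x v ∂ν = 0 := by
  have h1 := integrable_ccs ν (cd_D hg v).continuous (hcs_D hc v)
  have h2 := integrable_ccs ν hg.continuous hc
  have := integral_mul_fderiv_eq_neg_fderiv_mul_of_integrable (μ := ν) (f := fun _ : E => (1 : ℝ))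
    (g := g) (v := v) (by simp) (by simpa using h1) (by simpa using h2)
    (fun x _ => by fun_prop) (fun x _ => (hg.differentiable (by simp)) x)
  simpa using this

lemma D_mul {p q : E → ℝ} (hp : ContDiff ℝ (⊤ : ℕ∞) p) (hq : ContDiff ℝ (⊤ : ℕ∞) q) (x v : E) :
    fderiv ℝ (fun x => p x * q x) x v = p x * fderiv ℝ q x v + fderiv ℝ p x v * q x := by
  rw [fderiv_fun_mul ((hp.differentiable (by simp)) x) ((hq.differentiable (by simp)) x)]
  simp [mul_comm]

lemma D_add {p q : E → ℝ} (hp : ContDiff ℝ (⊤ : ℕ∞) p) (hq : ContDiff ℝ (⊤ : ℕ∞) q) (x v : E) :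
    fderiv ℝ (fun x => p x + q x) x v = fderiv ℝ p x v + fderiv ℝ q x v := by
  rw [fderiv_fun_add ((hp.differentiable (by simp)) x) ((hq.differentiable (by simp)) x)]
  simp

lemma D_comm {f : E → ℝ} (hf : ContDiff ℝ (⊤ : ℕ∞) f) (x v w : E) :
    fderiv ℝ (fun y => fderiv ℝ f y v) x w = fderiv ℝ (fun y => fderiv ℝ f y w) x v := by
  have hd : DifferentiableAt ℝ (fderiv ℝ f) x :=
    ((hf.fderiv_right (m := (⊤ : ℕ∞)) (by simp)).differentiable (by simp)) x
  have hs : IsSymmSndFDerivAt ℝ f x :=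
    hf.contDiffAt.isSymmSndFDerivAt (by simp; exact WithTop.coe_le_coe.2 le_top)
  rw [fderiv_clm_apply hd (by fun_prop), fderiv_clm_apply hd (by fun_prop)]
  simpa using hs w v

lemma D_clm (l : E →L[ℝ] ℝ) (x v : E) : fderiv ℝ (fun x => l x) x v = l v := by
  rw [show (fun x => l x) = ⇑l from rfl, l.fderiv]

end helpers
section grushin

variable {n m : ℕ}

/-- basis vectors -/
def e1 (n m : ℕ) (j : Fin n) : Ep n m := (EuclideanSpace.single j 1, 0)
/-- basis vectors -/
def e2 (n m : ℕ) (k : Fin m) : Ep n m := (0, EuclideanSpace.single k 1)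

lemma pdFst_eq (j : Fin n) {f : Ep n m → ℝ} (hf : ContDiff ℝ (⊤ : ℕ∞) f) :
    pdFst j f = fun x => fderiv ℝ f x (e1 n m j) := by
  funext x
  have h := ((hf.differentiable (by simp)) x).hasFDerivAt
  have := (h.hasLineDerivAt (e1 n m j)).lineDeriv
  rw [← this]
  unfold pdFst lineDeriv
  congr 1; funext s; congr 1
  simp [e1, Prod.ext_iff]

lemma pdSnd_eq (k : Fin m) {f : Ep n m → ℝ} (hf : ContDiff ℝ (⊤ : ℕ∞) f) :
    pdSnd k f = fun x => fderiv ℝ f x (e2 n m k) := by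
  funext x
  have h := ((hf.differentiable (by simp)) x).hasFDerivAt
  have := (h.hasLineDerivAt (e2 n m k)).lineDeriv
  rw [← this]
  unfold pdSnd lineDeriv
  congr 1; funext s; congr 1
  simp [e2, Prod.ext_iff]

lemma G_eq (a : EuclideanSpace ℝ (Fin n)) (b : Fin n → Fin m → ℝ)
    {f : Ep n m → ℝ} (hf : ContDiff ℝ (⊤ : ℕ∞) f) (x : Ep n m) :
    Gdrift a b f x =
      -(∑ j, fderiv ℝ (fun y => fderiv ℝ f y (e1 n m j)) x (e1 n m j))
      - ‖x.1‖ ^ 2 * ∑ k, fderiv ℝ (fun y => fderiv ℝ f y (e2 n m k)) x (e2 n m k)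
      - 2 * ∑ j, a j * fderiv ℝ f x (e1 n m j)
      - 2 * ∑ j, ∑ k, b j k * (x.1 j * fderiv ℝ f x (e2 n m k)) := by
  unfold Gdrift
  simp_rw [pdFst_eq _ hf, pdSnd_eq _ hf, pdFst_eq _ (cd_D hf _), pdSnd_eq _ (cd_D hf _)]

lemma G_cd (a : EuclideanSpace ℝ (Fin n)) (b : Fin n → Fin m → ℝ)
    {f : Ep n m → ℝ} (hf : ContDiff ℝ (⊤ : ℕ∞) f) : Continuous (Gdrift a b f) := by
  rw [funext (G_eq a b hf)]
  have h1 := fun v => (cd_D hf v).continuous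
  have h2 := fun v w => (cd_D (cd_D hf v) w).continuous
  fun_prop

lemma G_local (a : EuclideanSpace ℝ (Fin n)) (b : Fin n → Fin m → ℝ)
    {f g : Ep n m → ℝ} (hf : ContDiff ℝ (⊤ : ℕ∞) f) (hg : ContDiff ℝ (⊤ : ℕ∞) g) (x : Ep n m)
    (h : f =ᶠ[nhds x] g) : Gdrift a b f x = Gdrift a b g x := by
  rw [G_eq a b hf, G_eq a b hg]
  have h1 : ∀ v, (fun y => fderiv ℝ f y v) =ᶠ[nhds x] (fun y => fderiv ℝ g y v) := by
    intro v
    filter_upwards [h.fderiv (𝕜 := ℝ)] with y hy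
    rw [hy]
  have h2 := fun v => (h1 v).fderiv_eq (𝕜 := ℝ)
  simp only [h2, h.fderiv_eq]

lemma G_zero (a : EuclideanSpace ℝ (Fin n)) (b : Fin n → Fin m → ℝ) (c : ℝ) (x : Ep n m) :
    Gdrift a b (fun _ => c) x = 0 := by
  rw [G_eq a b contDiff_const]; simp

lemma G_supp (a : EuclideanSpace ℝ (Fin n)) (b : Fin n → Fin m → ℝ)
    {g : Ep n m → ℝ} (hg : ContDiff ℝ (⊤ : ℕ∞) g) (x : Ep n m) (hx : x ∉ tsupport g) :
    Gdrift a b g x = 0 := by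
  rw [G_local a b hg (g := fun _ => 0) contDiff_const x (notMem_tsupport_iff_eventuallyEq.1 hx),
    G_zero]

lemma G_hcs (a : EuclideanSpace ℝ (Fin n)) (b : Fin n → Fin m → ℝ)
    {g : Ep n m → ℝ} (hg : ContDiff ℝ (⊤ : ℕ∞) g) (hc : HasCompactSupport g) :
    HasCompactSupport (Gdrift a b g) :=
  HasCompactSupport.intro hc (fun x hx => G_supp a b hg x hx)

lemma cd_N : ContDiff ℝ (⊤ : ℕ∞) (fun x : Ep n m => ‖x.1‖ ^ 2) := contDiff_fst.norm_sq ℝ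

lemma D_N (x v : Ep n m) : fderiv ℝ (fun x : Ep n m => ‖x.1‖ ^ 2) x v = 2 * inner ℝ x.1 v.1 := by
  have := (hasFDerivAt_fst (𝕜 := ℝ) (p := x)).norm_sq
  rw [this.fderiv]; simp

lemma cd_exp (a : EuclideanSpace ℝ (Fin n)) (s : ℝ) :
    ContDiff ℝ (⊤ : ℕ∞) (fun x : Ep n m => Real.exp (s * dotp a x.1)) := by
  unfold dotp; fun_prop

lemma dotp_eq (a x : EuclideanSpace ℝ (Fin n)) : dotp a x = inner ℝ a x := by
  simp [dotp, PiLp.inner_apply, mul_comm]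

lemma D_exp (a : EuclideanSpace ℝ (Fin n)) (s : ℝ) (x v : Ep n m) :
    fderiv ℝ (fun x : Ep n m => Real.exp (s * dotp a x.1)) x v
      = Real.exp (s * dotp a x.1) * (s * dotp a v.1) := by
  simp_rw [dotp_eq]
  have h : HasFDerivAt (fun x : Ep n m => s * inner ℝ a x.1)
      (s • ((innerSL ℝ a).comp (ContinuousLinearMap.fst ℝ _ _)) : Ep n m →L[ℝ] ℝ) x :=
    ContinuousLinearMap.hasFDerivAt
      (s • ((innerSL ℝ a).comp (ContinuousLinearMap.fst ℝ _ _)) : Ep n m →L[ℝ] ℝ)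
  rw [h.exp.fderiv]; simp

@[simp] lemma dotp_e1 (a : EuclideanSpace ℝ (Fin n)) (j : Fin n) : dotp a (e1 n m j).1 = a j := by
  simp [dotp, e1]
@[simp] lemma dotp_e2 (a : EuclideanSpace ℝ (Fin n)) (j : Fin m) : dotp a (e2 n m j).1 = 0 := by
  simp [dotp, e2]

/-- Symmetry extends to noncompactly supported `f`. -/
lemma ext_sym {a : EuclideanSpace ℝ (Fin n)} {b : Fin n → Fin m → ℝ} {μ : Measure (Ep n m)}
    (H : ∀ f g : Ep n m → ℝ,
        ContDiff ℝ (⊤ : ℕ∞) f → HasCompactSupport f → ContDiff ℝ (⊤ : ℕ∞) g → HasCompactSupport g →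
        ∫ x, Gdrift a b f x * g x ∂μ = ∫ x, f x * Gdrift a b g x ∂μ)
    {f g : Ep n m → ℝ} (hf : ContDiff ℝ (⊤ : ℕ∞) f) (hg : ContDiff ℝ (⊤ : ℕ∞) g)
    (hc : HasCompactSupport g) :
    ∫ x, Gdrift a b f x * g x ∂μ = ∫ x, f x * Gdrift a b g x ∂μ := by
  obtain ⟨R, hR0, hR⟩ := hc.isCompact.isBounded.subset_ball_lt 0 0
  let χ : ContDiffBump (0 : Ep n m) := ⟨R, R + 1, hR0, by linarith⟩
  have hχ : ContDiff ℝ (⊤ : ℕ∞) χ := χ.contDiff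
  have hloc : ∀ x ∈ tsupport g, (fun y => χ y * f y) =ᶠ[nhds x] f := by
    intro x hx
    filter_upwards [χ.eventuallyEq_one_of_mem_ball (hR hx)] with y hy
    rw [hy]; simp
  have := H (fun y => χ y * f y) g (hχ.mul hf) (χ.hasCompactSupport.mul_right) hg hc
  convert this using 1
  · congr 1; funext x
    by_cases hx : x ∈ tsupport g
    · rw [G_local a b (hχ.mul hf) hf x (hloc x hx)]
    · rw [image_eq_zero_of_notMem_tsupport hx]; simp
  · congr 1; funext x
    by_cases hx : x ∈ tsupport g
    · have h3 : χ x * f x = f x := (hloc x hx).self_of_nhds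
      rw [h3]
    · rw [G_supp a b hg x hx]; simp

lemma G_clm (a : EuclideanSpace ℝ (Fin n)) (b : Fin n → Fin m → ℝ) (l : Ep n m →L[ℝ] ℝ)
    (x : Ep n m) : Gdrift a b l x = - 2 * ∑ j, a j * l (e1 n m j)
      - 2 * ∑ j, ∑ k, b j k * (x.1 j * l (e2 n m k)) := by
  rw [G_eq a b l.contDiff]; simp

lemma G_clm_mul (a : EuclideanSpace ℝ (Fin n)) (b : Fin n → Fin m → ℝ) (l : Ep n m →L[ℝ] ℝ)
    {g : Ep n m → ℝ} (hg : ContDiff ℝ (⊤ : ℕ∞) g) (x : Ep n m) :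
    Gdrift a b (fun x => l x * g x) x = l x * Gdrift a b g x + Gdrift a b l x * g x
      - 2 * (∑ j, l (e1 n m j) * fderiv ℝ g x (e1 n m j)
        + ‖x.1‖ ^ 2 * ∑ k, l (e2 n m k) * fderiv ℝ g x (e2 n m k)) := by
  have hl : ContDiff ℝ (⊤ : ℕ∞) (fun x => l x) := l.contDiff
  have h1 : ∀ v y, fderiv ℝ (fun x => l x * g x) y v = l y * fderiv ℝ g y v + l v * g y := by
    intro v y; rw [D_mul hl hg, D_clm]
  have h2 : ∀ v, fderiv ℝ (fun y => fderiv ℝ (fun x => l x * g x) y v) x v =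
      l x * fderiv ℝ (fun y => fderiv ℝ g y v) x v + 2 * (l v * fderiv ℝ g x v) := by
    intro v
    simp_rw [h1]
    rw [D_add (hl.mul (cd_D hg v)) (contDiff_const.mul hg), D_mul hl (cd_D hg v),
      D_mul contDiff_const hg, D_clm]
    simp; ring
  rw [G_eq a b (hl.mul hg), G_eq a b hg, G_clm]
  simp_rw [h2, h1, mul_add, Finset.sum_add_distrib]
  have r1 : ∑ j, a j * (l x * fderiv ℝ g x (e1 n m j)) = l x * ∑ j, a j * fderiv ℝ g x (e1 n m j) := by
    rw [Finset.mul_sum]; congr 1; funext j; ring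
  have r2 : ∑ j, a j * (l (e1 n m j) * g x) = (∑ j, a j * l (e1 n m j)) * g x := by
    rw [Finset.sum_mul]; congr 1; funext j; ring
  have r3 : ∑ j, ∑ k, b j k * (x.1 j * (l x * fderiv ℝ g x (e2 n m k))) =
      l x * ∑ j, ∑ k, b j k * (x.1 j * fderiv ℝ g x (e2 n m k)) := by
    simp_rw [Finset.mul_sum]; congr 1; funext j; congr 1; funext k; ring
  have r4 : ∑ j, ∑ k, b j k * (x.1 j * (l (e2 n m k) * g x)) =
      (∑ j, ∑ k, b j k * (x.1 j * l (e2 n m k))) * g x := by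
    simp_rw [Finset.sum_mul]; congr 1; funext j; congr 1; funext k; ring
  rw [r1, r2, r3, r4]
  simp_rw [← Finset.mul_sum]
  ring

lemma key_identity {a : EuclideanSpace ℝ (Fin n)} {b : Fin n → Fin m → ℝ} {μ : Measure (Ep n m)}
    [IsLocallyFiniteMeasure μ]
    (H : ∀ f g : Ep n m → ℝ,
        ContDiff ℝ (⊤ : ℕ∞) f → HasCompactSupport f → ContDiff ℝ (⊤ : ℕ∞) g → HasCompactSupport g →
        ∫ x, Gdrift a b f x * g x ∂μ = ∫ x, f x * Gdrift a b g x ∂μ)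
    {g : Ep n m → ℝ} (hg : ContDiff ℝ (⊤ : ℕ∞) g)
    (hc : HasCompactSupport g) (l : Ep n m →L[ℝ] ℝ) :
    ∫ x, ((∑ j, l (e1 n m j) * fderiv ℝ g x (e1 n m j)
        + ‖x.1‖ ^ 2 * ∑ k, l (e2 n m k) * fderiv ℝ g x (e2 n m k)) +
      (2 * ∑ j, a j * l (e1 n m j)
      + 2 * ∑ j, ∑ k, b j k * (x.1 j * l (e2 n m k))) * g x) ∂μ = 0 := by
  have hl : ContDiff ℝ (⊤ : ℕ∞) (fun x => l x) := l.contDiff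
  have hlg : HasCompactSupport (fun x => l x * g x) := hc.mul_left
  have h1 := ext_sym H (contDiff_const (c := (1 : ℝ))) (hl.mul hg) hlg
  simp only [G_zero, zero_mul, integral_zero, one_mul] at h1
  have h2 := ext_sym H hl hg hc
  have i1 := integrable_ccs μ (G_cd a b (hl.mul hg)) (G_hcs a b (hl.mul hg) hlg)
  have i2 : Integrable (fun x => Gdrift a b (fun x => l x) x * g x) μ := integrable_ccs μ ((G_cd a b hl).mul hg.continuous) hc.mul_left
  have i3 : Integrable (fun x => l x * Gdrift a b g x) μ :=
    integrable_ccs μ (hl.continuous.mul (G_cd a b hg)) (G_hcs a b hg hc).mul_left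
  have h3 : ∫ x, ((Gdrift a b (fun x => l x) x * g x - l x * Gdrift a b g x) +
      Gdrift a b (fun x => l x * g x) x) ∂μ = 0 := by
    have i4 : Integrable (fun x => Gdrift a b (fun x => l x) x * g x - l x * Gdrift a b g x) μ :=
      i2.sub i3
    rw [integral_add i4 i1, integral_sub i2 i3, h2, ← h1]; simp
  have h4 := congrArg (fun t => (-(1/2) : ℝ) * t) h3
  simp only [← integral_const_mul, mul_zero] at h4
  rw [← h4]
  congr 1; funext x
  rw [G_clm_mul a b l hg, show (fun x => l x) = ⇑l from rfl, G_clm]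
  ring

/-- Coordinate functional. -/
def x1 (n m : ℕ) (j : Fin n) : Ep n m →L[ℝ] ℝ :=
  (EuclideanSpace.proj j).comp (ContinuousLinearMap.fst ℝ _ _)
/-- Coordinate functional. -/
def x2 (n m : ℕ) (k : Fin m) : Ep n m →L[ℝ] ℝ :=
  (EuclideanSpace.proj k).comp (ContinuousLinearMap.snd ℝ _ _)

@[simp] lemma x1_apply (j : Fin n) (x : Ep n m) : x1 n m j x = x.1 j := rfl
@[simp] lemma x2_apply (j : Fin m) (x : Ep n m) : x2 n m j x = x.2 j := rfl

/-- The weighted measure `e^{-2 a x'} μ`. -/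
def lam (a : EuclideanSpace ℝ (Fin n)) (μ : Measure (Ep n m)) : Measure (Ep n m) :=
  μ.withDensity fun x => ENNReal.ofReal (Real.exp ((-2) * dotp a x.1))

lemma integral_wd (μ : Measure (Ep n m)) {w : Ep n m → ℝ} (hw : Continuous w) (h0 : ∀ x, 0 ≤ w x)
    (F : Ep n m → ℝ) :
    ∫ x, F x ∂(μ.withDensity fun x => ENNReal.ofReal (w x)) = ∫ x, w x * F x ∂μ := by
  rw [integral_withDensity_eq_integral_toReal_smul (by fun_prop)
    (Filter.Eventually.of_forall fun x => ENNReal.ofReal_lt_top)]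
  congr 1; funext x
  rw [ENNReal.toReal_ofReal (h0 x), smul_eq_mul]

lemma integral_lam (a : EuclideanSpace ℝ (Fin n)) (μ : Measure (Ep n m)) (F : Ep n m → ℝ) :
    ∫ x, F x ∂(lam a μ) = ∫ x, Real.exp ((-2) * dotp a x.1) * F x ∂μ :=
  integral_wd μ (cd_exp a (-2)).continuous (fun _ => (Real.exp_pos _).le) F

lemma lam_lf (a : EuclideanSpace ℝ (Fin n)) (μ : Measure (Ep n m)) [IsLocallyFiniteMeasure μ] :
    IsLocallyFiniteMeasure (lam a μ) :=
  IsLocallyFiniteMeasure.withDensity_ofReal (cd_exp a (-2)).continuous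

lemma lam_inv (a : EuclideanSpace ℝ (Fin n)) (μ : Measure (Ep n m)) :
    μ = (lam a μ).withDensity fun x => ENNReal.ofReal (Real.exp (2 * dotp a x.1)) := by
  have h : Measurable (fun x : Ep n m => ENNReal.ofReal (Real.exp ((-2) * dotp a x.1))) := by
    have := (cd_exp (m := m) a (-2)).continuous
    exact ENNReal.measurable_ofReal.comp this.measurable
  have := withDensity_inv_same (μ := μ) h
    (Filter.Eventually.of_forall fun x => by simp [Real.exp_pos])
    (Filter.Eventually.of_forall fun x => ENNReal.ofReal_ne_top)
  refine this.symm.trans ?_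
  congr 1; funext x
  rw [← ENNReal.ofReal_inv_of_pos (Real.exp_pos _), ← Real.exp_neg]
  congr 2; ring

lemma P1 {a : EuclideanSpace ℝ (Fin n)} {b : Fin n → Fin m → ℝ} {μ : Measure (Ep n m)}
    [IsLocallyFiniteMeasure μ]
    (H : ∀ f g : Ep n m → ℝ,
        ContDiff ℝ (⊤ : ℕ∞) f → HasCompactSupport f → ContDiff ℝ (⊤ : ℕ∞) g → HasCompactSupport g →
        ∫ x, Gdrift a b f x * g x ∂μ = ∫ x, f x * Gdrift a b g x ∂μ)
    {h : Ep n m → ℝ} (hg : ContDiff ℝ (⊤ : ℕ∞) h)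
    (hc : HasCompactSupport h) (j : Fin n) :
    ∫ x, fderiv ℝ h x (e1 n m j) ∂(lam a μ) = 0 := by
  have := key_identity H ((cd_exp a (-2)).mul hg) hc.mul_left (x1 n m j)
  rw [integral_lam, ← this]
  congr 1; funext x
  simp_rw [D_mul (cd_exp a (-2)) hg, D_exp]
  simp [e1, e2, dotp]
  ring

lemma P2 {a : EuclideanSpace ℝ (Fin n)} {b : Fin n → Fin m → ℝ} {μ : Measure (Ep n m)}
    [IsLocallyFiniteMeasure μ]
    (H : ∀ f g : Ep n m → ℝ,
        ContDiff ℝ (⊤ : ℕ∞) f → HasCompactSupport f → ContDiff ℝ (⊤ : ℕ∞) g → HasCompactSupport g →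
        ∫ x, Gdrift a b f x * g x ∂μ = ∫ x, f x * Gdrift a b g x ∂μ)
    {h : Ep n m → ℝ} (hg : ContDiff ℝ (⊤ : ℕ∞) h)
    (hc : HasCompactSupport h) (k : Fin m) :
    ∫ x, (‖x.1‖ ^ 2 * fderiv ℝ h x (e2 n m k) + (∑ j, (2 * b j k) • x1 n m j) x * h x) ∂(lam a μ)
      = 0 := by
  have := key_identity H ((cd_exp a (-2)).mul hg) hc.mul_left (x2 n m k)
  rw [integral_lam, ← this]
  congr 1; funext x
  simp_rw [D_mul (cd_exp a (-2)) hg, D_exp]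
  simp [e1, e2, dotp, Finset.mul_sum, Finset.sum_mul]
  rw [mul_add, Finset.mul_sum]
  congr 1
  · ring
  · congr 1; funext j; ring

end grushin
section conclude

variable {n m : ℕ}

lemma int_sub_zero {μ : Measure (Ep n m)} [IsLocallyFiniteMeasure μ] {p q : Ep n m → ℝ}
    (hp : ContDiff ℝ (⊤ : ℕ∞) p) (hpc : HasCompactSupport p)
    (hq : ContDiff ℝ (⊤ : ℕ∞) q) (hqc : HasCompactSupport q)
    (h1 : ∫ x, p x ∂μ = 0) (h2 : ∫ x, q x ∂μ = 0) : ∫ x, (p x - q x) ∂μ = 0 := by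
  rw [integral_sub (integrable_ccs μ hp.continuous hpc) (integrable_ccs μ hq.continuous hqc), h1, h2,
    sub_zero]

lemma P3 {μ : Measure (Ep n m)} [IsLocallyFiniteMeasure μ] (b : Fin n → Fin m → ℝ)
    (h1 : ∀ h : Ep n m → ℝ, ContDiff ℝ (⊤ : ℕ∞) h → HasCompactSupport h → ∀ j : Fin n,
      ∫ x, fderiv ℝ h x (e1 n m j) ∂μ = 0)
    (h2 : ∀ h : Ep n m → ℝ, ContDiff ℝ (⊤ : ℕ∞) h → HasCompactSupport h → ∀ k : Fin m,
      ∫ x, (‖x.1‖ ^ 2 * fderiv ℝ h x (e2 n m k) + (∑ j, (2 * b j k) • x1 n m j) x * h x) ∂μ = 0)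
    (h : Ep n m → ℝ) (hh : ContDiff ℝ (⊤ : ℕ∞) h) (hc : HasCompactSupport h) (i : Fin n) (k : Fin m) :
    ∫ x, (x1 n m i x * fderiv ℝ h x (e2 n m k) + b i k * h x) ∂μ = 0 := by
  set B := (∑ j, (2 * b j k) • x1 n m j) with hB
  have hBc : ContDiff ℝ (⊤ : ℕ∞) (fun x => B x) := B.contDiff
  have hBi : B (e1 n m i) = 2 * b i k := by
    simp [hB, e1]
  have cF : ∀ g : Ep n m → ℝ, ContDiff ℝ (⊤ : ℕ∞) g → ContDiff ℝ (⊤ : ℕ∞)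
      (fun x => ‖x.1‖ ^ 2 * fderiv ℝ g x (e2 n m k) + B x * g x) := fun g hg =>
    (cd_N.mul (cd_D hg _)).add (hBc.mul hg)
  have sF : ∀ g : Ep n m → ℝ, HasCompactSupport g → HasCompactSupport
      (fun x => ‖x.1‖ ^ 2 * fderiv ℝ g x (e2 n m k) + B x * g x) := fun g hg =>
    ((hcs_D hg _).mul_left).add (hg.mul_left)
  have A1 := h1 _ (cF h hh) (sF h hc) i
  have A2 := h2 _ (cd_D hh (e1 n m i)) (hcs_D hc _) k
  have A3 := int_sub_zero (cd_D (cF h hh) (e1 n m i)) (hcs_D (sF h hc) _)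
    (cF _ (cd_D hh (e1 n m i))) (sF _ (hcs_D hc _)) A1 A2
  have A4 := congrArg (fun t => (1/2 : ℝ) * t) A3
  simp only [← integral_const_mul, mul_zero] at A4
  rw [← A4]
  congr 1; funext x
  rw [D_add (cd_N.mul (cd_D hh _)) (hBc.mul hh), D_mul cd_N (cd_D hh _), D_mul hBc hh, D_clm, D_N,
    D_comm hh x (e2 n m k), hBi]
  simp [e1, EuclideanSpace.inner_single_right]
  ring

lemma P4 {μ : Measure (Ep n m)} [IsLocallyFiniteMeasure μ] (b : Fin n → Fin m → ℝ)
    (h1 : ∀ h : Ep n m → ℝ, ContDiff ℝ (⊤ : ℕ∞) h → HasCompactSupport h → ∀ j : Fin n,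
      ∫ x, fderiv ℝ h x (e1 n m j) ∂μ = 0)
    (h3 : ∀ h : Ep n m → ℝ, ContDiff ℝ (⊤ : ℕ∞) h → HasCompactSupport h → ∀ (i : Fin n) (k : Fin m),
      ∫ x, (x1 n m i x * fderiv ℝ h x (e2 n m k) + b i k * h x) ∂μ = 0)
    (h : Ep n m → ℝ) (hh : ContDiff ℝ (⊤ : ℕ∞) h) (hc : HasCompactSupport h) (i : Fin n) (k : Fin m) :
    ∫ x, fderiv ℝ h x (e2 n m k) ∂μ = 0 := by
  have hBc : ContDiff ℝ (⊤ : ℕ∞) (fun x => x1 n m i x) := (x1 n m i).contDiff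
  have cF : ∀ g : Ep n m → ℝ, ContDiff ℝ (⊤ : ℕ∞) g → ContDiff ℝ (⊤ : ℕ∞)
      (fun x => x1 n m i x * fderiv ℝ g x (e2 n m k) + b i k * g x) := fun g hg =>
    (hBc.mul (cd_D hg _)).add (contDiff_const.mul hg)
  have sF : ∀ g : Ep n m → ℝ, HasCompactSupport g → HasCompactSupport
      (fun x => x1 n m i x * fderiv ℝ g x (e2 n m k) + b i k * g x) := fun g hg =>
    ((hcs_D hg _).mul_left).add (hg.mul_left (f := fun _ => b i k))
  have A1 := h1 _ (cF h hh) (sF h hc) i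
  have A2 := h3 _ (cd_D hh (e1 n m i)) (hcs_D hc _) i k
  have A3 := int_sub_zero (cd_D (cF h hh) (e1 n m i)) (hcs_D (sF h hc) _)
    (cF _ (cd_D hh (e1 n m i))) (sF _ (hcs_D hc _)) A1 A2
  rw [← A3]
  congr 1; funext x
  rw [D_add (hBc.mul (cd_D hh _)) (contDiff_const.mul hh), D_mul hBc (cd_D hh _),
    D_mul contDiff_const hh, D_clm, D_comm hh x (e2 n m k)]
  simp [e1]

lemma P5 {μ : Measure (Ep n m)} [IsLocallyFiniteMeasure μ] (b : Fin n → Fin m → ℝ) (hμ : μ ≠ 0)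
    (h3 : ∀ h : Ep n m → ℝ, ContDiff ℝ (⊤ : ℕ∞) h → HasCompactSupport h → ∀ (i : Fin n) (k : Fin m),
      ∫ x, (x1 n m i x * fderiv ℝ h x (e2 n m k) + b i k * h x) ∂μ = 0)
    (h4 : ∀ h : Ep n m → ℝ, ContDiff ℝ (⊤ : ℕ∞) h → HasCompactSupport h → ∀ (k : Fin m),
      ∫ x, fderiv ℝ h x (e2 n m k) ∂μ = 0) (i : Fin n) (k : Fin m) : b i k = 0 := by
  by_contra hb
  apply hμ
  apply measure_eq_of_smooth
  intro h hh hc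
  have hBc : ContDiff ℝ (⊤ : ℕ∞) (fun x => x1 n m i x) := (x1 n m i).contDiff
  have A1 := h3 h hh hc i k
  have A2 := h4 _ (hBc.mul hh) hc.mul_left k
  have A3 := int_sub_zero ((hBc.mul (cd_D hh _)).add (contDiff_const.mul hh))
    (((hcs_D hc _).mul_left).add (hc.mul_left (f := fun _ => b i k)))
    (cd_D (hBc.mul hh) (e2 n m k)) (hcs_D hc.mul_left _) A1 A2
  have A4 : ∫ x, b i k * h x ∂μ = 0 := by
    rw [← A3]
    congr 1; funext x
    rw [D_mul hBc hh, D_clm]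
    simp [e2]
  rw [integral_const_mul] at A4
  simpa [hb] using A4

lemma vec_eq (v : Ep n m) : v = ∑ j, v.1 j • e1 n m j + ∑ k, v.2 k • e2 n m k := by
  refine Prod.ext ?_ ?_
  · ext i
    simp [e1, e2, Prod.fst_sum, Pi.single_apply]
  · ext i
    simp [e1, e2, Prod.snd_sum, Pi.single_apply]

lemma P6 {μ : Measure (Ep n m)} [IsLocallyFiniteMeasure μ]
    (h1 : ∀ h : Ep n m → ℝ, ContDiff ℝ (⊤ : ℕ∞) h → HasCompactSupport h → ∀ j : Fin n,
      ∫ x, fderiv ℝ h x (e1 n m j) ∂μ = 0)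
    (h4 : ∀ h : Ep n m → ℝ, ContDiff ℝ (⊤ : ℕ∞) h → HasCompactSupport h → ∀ (k : Fin m),
      ∫ x, fderiv ℝ h x (e2 n m k) ∂μ = 0)
    (h : Ep n m → ℝ) (hh : ContDiff ℝ (⊤ : ℕ∞) h) (hc : HasCompactSupport h) (v : Ep n m) :
    ∫ x, fderiv ℝ h x v ∂μ = 0 := by
  have hi : ∀ w, Integrable (fun x => fderiv ℝ h x w) μ := fun w =>
    integrable_ccs μ (cd_D hh w).continuous (hcs_D hc w)
  have e : ∀ x, fderiv ℝ h x v = ∑ j, v.1 j * fderiv ℝ h x (e1 n m j)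
      + ∑ k, v.2 k * fderiv ℝ h x (e2 n m k) := by
    intro x
    conv_lhs => rw [vec_eq v]
    simp
  simp_rw [e]
  rw [integral_add (integrable_finsetSum _ fun j _ => (hi _).const_mul _)
    (integrable_finsetSum _ fun j _ => (hi _).const_mul _),
    integral_finsetSum _ fun j _ => (hi _).const_mul _,
    integral_finsetSum _ fun j _ => (hi _).const_mul _]
  simp [integral_const_mul, h1 h hh hc, h4 h hh hc]

lemma converse (a : EuclideanSpace ℝ (Fin n)) (c : ℝ) (hc0 : 0 < c)
    (f g : Ep n m → ℝ) (hf : ContDiff ℝ (⊤ : ℕ∞) f) (hfc : HasCompactSupport f)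
    (hg : ContDiff ℝ (⊤ : ℕ∞) g) (hgc : HasCompactSupport g) :
    ∫ x, Gdrift a 0 f x * g x ∂((volume : Measure (Ep n m)).withDensity
        fun x => ENNReal.ofReal (c * Real.exp (2 * dotp a x.1)))
      = ∫ x, f x * Gdrift a 0 g x ∂((volume : Measure (Ep n m)).withDensity
        fun x => ENNReal.ofReal (c * Real.exp (2 * dotp a x.1))) := by
  have hw := cd_exp (m := m) a 2
  have hwc : Continuous (fun x : Ep n m => c * Real.exp (2 * dotp a x.1)) :=
    continuous_const.mul hw.continuous
  have hw0 : ∀ x : Ep n m, 0 ≤ c * Real.exp (2 * dotp a x.1) := fun x => by positivity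
  rw [integral_wd _ hwc hw0, integral_wd _ hwc hw0]
  have hV : (volume : Measure (Ep n m)).IsAddHaarMeasure := by
    rw [Measure.volume_eq_prod]; infer_instance
  -- the antisymmetric current
  have cJ : ∀ v, ContDiff ℝ (⊤ : ℕ∞) (fun x => f x * fderiv ℝ g x v + (-1) * (g x * fderiv ℝ f x v)) :=
    fun v => (hf.mul (cd_D hg v)).add (contDiff_const.mul (hg.mul (cd_D hf v)))
  have sJ : ∀ v, HasCompactSupport (fun x => f x * fderiv ℝ g x v + (-1) * (g x * fderiv ℝ f x v)) :=
    fun v => ((hcs_D hgc v).mul_left).add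
      (((hcs_D hfc v).mul_left (f := g)).mul_left (f := fun _ => (-1 : ℝ)))
  have DJ : ∀ v x, fderiv ℝ (fun x => f x * fderiv ℝ g x v + (-1) * (g x * fderiv ℝ f x v)) x v =
      f x * fderiv ℝ (fun y => fderiv ℝ g y v) x v - g x * fderiv ℝ (fun y => fderiv ℝ f y v) x v := by
    intro v x
    rw [D_add (hf.mul (cd_D hg v)) (contDiff_const.mul (hg.mul (cd_D hf v))),
      D_mul hf (cd_D hg v), D_mul contDiff_const (hg.mul (cd_D hf v)), D_mul hg (cd_D hf v)]
    simp; ring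
  have I1 : ∀ j, ∫ x, fderiv ℝ (fun x => Real.exp (2 * dotp a x.1) *
      (f x * fderiv ℝ g x (e1 n m j) + (-1) * (g x * fderiv ℝ f x (e1 n m j)))) x (e1 n m j) = 0 :=
    fun j => integral_D volume (hw.mul (cJ _)) (sJ _).mul_left _
  have I2 : ∀ k, ∫ x, fderiv ℝ (fun x => (Real.exp (2 * dotp a x.1) * ‖x.1‖ ^ 2) *
      (f x * fderiv ℝ g x (e2 n m k) + (-1) * (g x * fderiv ℝ f x (e2 n m k)))) x (e2 n m k) = 0 :=
    fun j => integral_D volume ((hw.mul cd_N).mul (cJ _)) (sJ _).mul_left _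
  have T1 := fun j => integrable_ccs (volume : Measure (Ep n m))
    (cd_D (hw.mul (cJ (e1 n m j))) (e1 n m j)).continuous (hcs_D (sJ _).mul_left _)
  have T2 := fun k => integrable_ccs (volume : Measure (Ep n m))
    (cd_D ((hw.mul cd_N).mul (cJ (e2 n m k))) (e2 n m k)).continuous (hcs_D (sJ _).mul_left _)
  have J := integral_add (integrable_finsetSum Finset.univ fun j _ => T1 j)
    (integrable_finsetSum Finset.univ fun j _ => T2 j)
  rw [integral_finsetSum _ fun j _ => T1 j, integral_finsetSum _ fun j _ => T2 j] at J
  simp only [I1, I2, Finset.sum_const_zero, add_zero] at J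
  have i1 : Integrable (fun x => c * Real.exp (2 * dotp a x.1) * (Gdrift a 0 f x * g x))
      (volume : Measure (Ep n m)) :=
    integrable_ccs _ (hwc.mul ((G_cd a 0 hf).mul hg.continuous)) (hgc.mul_left.mul_left)
  have i2 : Integrable (fun x => c * Real.exp (2 * dotp a x.1) * (f x * Gdrift a 0 g x))
      (volume : Measure (Ep n m)) :=
    integrable_ccs _ (hwc.mul (hf.continuous.mul (G_cd a 0 hg))) (hfc.mul_right.mul_left)
  rw [← sub_eq_zero, ← integral_sub i1 i2]
  have J2 := congrArg (fun t => c * t) J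
  simp only [← integral_const_mul, mul_zero] at J2
  rw [← J2]
  congr 1; funext x
  simp_rw [D_mul hw (cJ _), D_mul (hw.mul cd_N) (cJ _), DJ, D_mul hw cd_N, D_exp, D_N, dotp_e1, dotp_e2]
  have z : ∀ k, inner ℝ x.1 (e2 n m k).1 = 0 := by intro k; simp [e2]
  simp_rw [z]
  rw [G_eq a 0 hf, G_eq a 0 hg]
  simp only [Pi.zero_apply, zero_mul, Finset.sum_const_zero, mul_zero, sub_zero, add_zero]
  simp only [Finset.sum_add_distrib, ← Finset.mul_sum, mul_add, mul_sub, Finset.sum_sub_distrib]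
  have r : ∑ j, Real.exp (2 * dotp a x.1) * (2 * a j) *
      (f x * fderiv ℝ g x (e1 n m j) + (-1) * (g x * fderiv ℝ f x (e1 n m j)))
      = Real.exp (2 * dotp a x.1) * 2 * (f x * ∑ j, a j * fderiv ℝ g x (e1 n m j)
        - g x * ∑ j, a j * fderiv ℝ f x (e1 n m j)) := by
    simp only [Finset.mul_sum, ← Finset.sum_sub_distrib]
    congr 1; funext j; ring
  simp only [Finset.sum_add_distrib, mul_add] at r
  linear_combination (-c) * r

end conclude

/-- **Theorem**: for a nonzero drift `ν = (a,b)`, the operator `G_ν` is symmetric with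
respect to a nonzero locally finite positive Borel measure `μ` on `ℝ^{n+m}` if and only if
`b = 0` and `dμ = c e^{2a·x'} dx` for some constant `c > 0`. -/
theorem grushin_drift_symmetric_iff (n m : ℕ) (hn : 1 ≤ n) (hm : 1 ≤ m)
    (a : EuclideanSpace ℝ (Fin n)) (b : Fin n → Fin m → ℝ) (hab : ¬(a = 0 ∧ b = 0))
    (μ : Measure (Ep n m)) [IsLocallyFiniteMeasure μ] (hμ : μ ≠ 0) :
    (∀ f g : Ep n m → ℝ,
        ContDiff ℝ (⊤ : ℕ∞) f → HasCompactSupport f → ContDiff ℝ (⊤ : ℕ∞) g → HasCompactSupport g →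
        ∫ x, Gdrift a b f x * g x ∂μ = ∫ x, f x * Gdrift a b g x ∂μ) ↔
      (b = 0 ∧ ∃ c : ℝ, 0 < c ∧
        μ = volume.withDensity fun x => ENNReal.ofReal (c * Real.exp (2 * dotp a x.1))) := by
  constructor
  · intro H
    have hlf := lam_lf a μ
    have hl0 : lam a μ ≠ 0 := by
      intro h0
      apply hμ
      rw [lam_inv a μ, h0]
      exact withDensity_zero_left _
    have h1 : ∀ h : Ep n m → ℝ, ContDiff ℝ (⊤ : ℕ∞) h → HasCompactSupport h → ∀ j : Fin n,
      ∫ x, fderiv ℝ h x (e1 n m j) ∂(lam a μ) = 0 := fun h hh hc j => P1 H hh hc j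
    have h3 := P3 (μ := lam a μ) b h1 (fun h hh hc k => P2 H hh hc k)
    have h4 := fun h hh hc k => P4 (μ := lam a μ) b h1 h3 h hh hc ⟨0, hn⟩ k
    refine ⟨?_, ?_⟩
    · funext i k
      exact P5 b hl0 h3 h4 i k
    · have hV : (volume : Measure (Ep n m)).IsAddHaarMeasure := by
        rw [Measure.volume_eq_prod]; infer_instance
      obtain ⟨c, hc, hlam⟩ := eq_smul_of_deriv (lam a μ) volume hl0 (P6 h1 h4)
      refine ⟨c, hc, ?_⟩
      have hm : Measurable fun x : Ep n m => ENNReal.ofReal (Real.exp (2 * dotp a x.1)) :=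
        ENNReal.measurable_ofReal.comp (cd_exp a 2).continuous.measurable
      rw [lam_inv a μ, hlam, withDensity_smul_measure, ← withDensity_smul _ hm]
      congr 1; funext x
      rw [Pi.smul_apply, smul_eq_mul, ENNReal.ofReal_mul hc.le]
  · rintro ⟨rfl, c, hc, rfl⟩ f g hf hfc hg hgc
    exact converse a c hc f g hf hfc hg hgc
end
end

section
/- There exist constants 0 < c ≤ C depending only on n and m such that for every nonzero a ∈ ℝ^n, every x ∈ ℝ^{n+m}, and every r > 0: if r ≤ 1/|a| then c e^{2a·x'} r^{n+m} (r+|x'|)^m ≤ μ_a(B(x,r)) ≤ C e^{2a·x'} r^{n+m} (r+|x'|)^m, and if r > 1/|a| then c |a|^{−(n+1)/2 − m} e^{2(a·x' + |a|r)} r^{(n−1)/2} (r+|x'|)^m ≤ μ_a(B(x,r)) ≤ C |a|^{−(n+1)/2 − m} e^{2(a·x' + |a|r)} r^{(n−1)/2} (r+|x'|)^m. -/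
noncomputable section
open MeasureTheory Real Set

/-- The measure `dμ_a = e^{2a·x'} dx` on `ℝ^{n+m}`. -/
def muG {n m : ℕ} (a : EuclideanSpace ℝ (Fin n)) : Measure (Ep n m) :=
  volume.withDensity fun x => ENNReal.ofReal (Real.exp (2 * dotp a x.1))

/-- The Grushin quasi-distance `d(x,y)`. -/
def grushinDist {n m : ℕ} (x y : Ep n m) : ℝ :=
  ‖x.1 - y.1‖ +
    if Real.sqrt ‖x.2 - y.2‖ ≤ ‖x.1‖ + ‖y.1‖ then ‖x.2 - y.2‖ / (‖x.1‖ + ‖y.1‖)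
    else Real.sqrt ‖x.2 - y.2‖

/-- The Grushin ball `B(x,r)`. -/
def grushinBall {n m : ℕ} (x : Ep n m) (r : ℝ) : Set (Ep n m) :=
  {y | grushinDist x y < r}


lemma dotp_eq_inner {n : ℕ} (a b : EuclideanSpace ℝ (Fin n)) : dotp a b = inner ℝ a b := by
  simp [dotp, PiLp.inner_apply, mul_comm]

/-- The reduced radial-exponential integral. -/
def redI (n m : ℕ) (a : EuclideanSpace ℝ (Fin n)) (r : ℝ) : ENNReal :=
  ∫⁻ z : EuclideanSpace ℝ (Fin n),
    ENNReal.ofReal (Real.exp (2 * dotp a z)) * ENNReal.ofReal (r - ‖z‖) ^ m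

/-- Volume of the unit ball. -/
def omg (n : ℕ) : ℝ := √π ^ n / Real.Gamma (n / 2 + 1)

lemma omg_pos (n : ℕ) : 0 < omg n := by
  unfold omg
  have : 0 < Real.Gamma ((n : ℝ) / 2 + 1) := Real.Gamma_pos_of_pos (by positivity)
  positivity

lemma vol_ball (n : ℕ) (hn : 1 ≤ n) (x : EuclideanSpace ℝ (Fin n)) (r : ℝ) :
    volume (Metric.ball x r) = ENNReal.ofReal r ^ n * ENNReal.ofReal (omg n) := by
  have : Nonempty (Fin n) := ⟨⟨0, hn⟩⟩
  rw [EuclideanSpace.volume_ball]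
  simp [omg]

lemma abs_dotp_le {n : ℕ} (a b : EuclideanSpace ℝ (Fin n)) : |dotp a b| ≤ ‖a‖ * ‖b‖ := by
  rw [dotp_eq_inner]; exact abs_real_inner_le_norm a b

lemma redI_small_upper (n m : ℕ) (hn : 1 ≤ n) (hm : 1 ≤ m) (a : EuclideanSpace ℝ (Fin n)) (r : ℝ)
    (hr : 0 < r) (h : ‖a‖ * r ≤ 1) :
    redI n m a r ≤ ENNReal.ofReal (Real.exp 2 * omg n * r ^ (n + m)) := by
  have key : ∀ z : EuclideanSpace ℝ (Fin n),
      ENNReal.ofReal (Real.exp (2 * dotp a z)) * ENNReal.ofReal (r - ‖z‖) ^ m ≤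
      (Metric.ball (0 : EuclideanSpace ℝ (Fin n)) r).indicator
        (fun _ => ENNReal.ofReal (Real.exp 2 * r ^ m)) z := by
    intro z
    by_cases hz : ‖z‖ < r
    · rw [indicator_of_mem (by simpa using hz), ← ENNReal.ofReal_pow (by linarith),
        ← ENNReal.ofReal_mul (by positivity)]
      apply ENNReal.ofReal_le_ofReal
      have h1 := (abs_le.1 (abs_dotp_le a z)).2
      have h2 : ‖a‖ * ‖z‖ ≤ ‖a‖ * r := by gcongr
      have h3 := norm_nonneg z
      have h4 : 0 ≤ r - ‖z‖ := by linarith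
      gcongr
      · linarith
      · linarith
    · rw [ENNReal.ofReal_of_nonpos (by linarith : r - ‖z‖ ≤ 0), zero_pow (by omega)]
      simp
  calc redI n m a r ≤ _ := lintegral_mono key
    _ = ENNReal.ofReal (Real.exp 2 * r ^ m) * volume (Metric.ball (0 : EuclideanSpace ℝ (Fin n)) r) :=
        lintegral_indicator_const measurableSet_ball _
    _ = _ := by
        rw [vol_ball n hn, ← ENNReal.ofReal_pow hr.le, ← ENNReal.ofReal_mul (by positivity),
          ← ENNReal.ofReal_mul (by positivity)]
        congr 1; ring

lemma redI_small_lower (n m : ℕ) (hn : 1 ≤ n) (a : EuclideanSpace ℝ (Fin n)) (r : ℝ)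
    (hr : 0 < r) (h : ‖a‖ * r ≤ 1) :
    ENNReal.ofReal (Real.exp (-1) * (1 / 2) ^ (n + m) * omg n * r ^ (n + m)) ≤ redI n m a r := by
  have key : ∀ z : EuclideanSpace ℝ (Fin n),
      (Metric.ball (0 : EuclideanSpace ℝ (Fin n)) (r / 2)).indicator
        (fun _ => ENNReal.ofReal (Real.exp (-1) * (r / 2) ^ m)) z ≤
      ENNReal.ofReal (Real.exp (2 * dotp a z)) * ENNReal.ofReal (r - ‖z‖) ^ m := by
    intro z
    by_cases hz : ‖z‖ < r / 2
    · rw [indicator_of_mem (by simpa using hz), ← ENNReal.ofReal_pow (by linarith),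
        ← ENNReal.ofReal_mul (by positivity)]
      apply ENNReal.ofReal_le_ofReal
      have h1 := (abs_le.1 (abs_dotp_le a z)).1
      have h2 : ‖a‖ * ‖z‖ ≤ ‖a‖ * (r / 2) := by gcongr
      gcongr
      · linarith
      · linarith
    · rw [indicator_of_notMem (by simpa using hz)]
      simp
  calc _ = ENNReal.ofReal (Real.exp (-1) * (r / 2) ^ m) *
          volume (Metric.ball (0 : EuclideanSpace ℝ (Fin n)) (r / 2)) := by
        rw [vol_ball n hn, ← ENNReal.ofReal_pow (by positivity), ← ENNReal.ofReal_mul (by positivity),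
          ← ENNReal.ofReal_mul (by positivity)]
        congr 1; simp only [div_pow, one_pow]; field_simp; ring
    _ = _ := (lintegral_indicator_const measurableSet_ball _).symm
    _ ≤ redI n m a r := lintegral_mono key

/-- Rotated coordinates adapted to `a`. -/
lemma exists_coords (k : ℕ) (a : EuclideanSpace ℝ (Fin (k + 1))) (ha : a ≠ 0) :
    ∃ φ : (Fin (k + 1) → ℝ) → EuclideanSpace ℝ (Fin (k + 1)),
      MeasurePreserving φ volume volume ∧ ∀ w, ‖φ w‖ ^ 2 = w 0 ^ 2 + ∑ i : Fin k, w i.succ ^ 2 ∧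
        dotp a (φ w) = ‖a‖ * w 0 := by
  have hA : ‖a‖ ≠ 0 := norm_ne_zero_iff.2 ha
  have hv : Orthonormal ℝ (({0} : Set (Fin (k + 1))).domRestrict (fun _ => (‖a‖⁻¹ • a))) := by
    constructor
    · rintro ⟨i, hi⟩
      simp [norm_smul, hA]
    · rintro ⟨i, hi⟩ ⟨j, hj⟩ hij
      simp only [mem_singleton_iff] at hi hj
      subst hi; subst hj
      exact absurd rfl hij
  obtain ⟨b, hb⟩ := hv.exists_orthonormalBasis_extension_of_card_eq (by simp)
  have hb0 : b 0 = ‖a‖⁻¹ • a := hb 0 rfl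
  have ha' : a = ‖a‖ • b 0 := by rw [hb0, smul_smul, mul_inv_cancel₀ hA, one_smul]
  refine ⟨fun w => b.repr.symm (WithLp.toLp 2 w),
    b.measurePreserving_repr_symm.comp (PiLp.volume_preserving_toLp (Fin (k + 1))), fun w => ⟨?_, ?_⟩⟩
  · rw [LinearIsometryEquiv.norm_map, EuclideanSpace.norm_sq_eq, Fin.sum_univ_succ]
    simp
  · rw [dotp_eq_inner]
    conv_lhs => rw [ha']
    rw [inner_smul_left, ← b.repr_apply_apply, LinearIsometryEquiv.apply_symm_apply]
    simp

lemma redI_coords (k m : ℕ) (a : EuclideanSpace ℝ (Fin (k + 1))) (r : ℝ)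
    (φ : (Fin (k + 1) → ℝ) → EuclideanSpace ℝ (Fin (k + 1))) (hφ : MeasurePreserving φ volume volume) :
    redI (k + 1) m a r = ∫⁻ w, ENNReal.ofReal (Real.exp (2 * dotp a (φ w))) *
      ENNReal.ofReal (r - ‖φ w‖) ^ m := by
  unfold redI
  rw [← hφ.lintegral_comp]
  simp only [dotp_eq_inner]
  fun_prop

lemma redI_large_upper (k m : ℕ) (hm : 1 ≤ m) (a : EuclideanSpace ℝ (Fin (k + 1))) (ha : a ≠ 0)
    (r : ℝ) (hr : 0 < r) :
    redI (k + 1) m a r ≤ ENNReal.ofReal (m.factorial * (‖a‖⁻¹) ^ m * Real.exp (‖a‖ * r) *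
      ((Real.exp (‖a‖ * r) / ‖a‖) * √(π / (‖a‖ / (2 * r))) ^ k)) := by
  obtain ⟨φ, hφ, hw⟩ := exists_coords k a ha
  rw [redI_coords k m a r φ hφ]
  have hA : 0 < ‖a‖ := norm_pos_iff.2 ha
  set A := ‖a‖ with hAdef
  let f0 : ℝ → ℝ := (Iic r).indicator (fun s => Real.exp (A * s))
  let g : ℝ → ℝ := fun t => Real.exp (-(A / (2 * r)) * t ^ 2)
  let f : Fin (k + 1) → ℝ → ℝ := Fin.cons f0 (fun _ => g)
  have hb : 0 < A / (2 * r) := by positivity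
  have hf0i : Integrable f0 := (integrable_indicator_iff measurableSet_Iic).2
    (integrableOn_exp_mul_Iic hA r)
  have hf0 : ∫ s, f0 s = Real.exp (A * r) / A := by
    rw [integral_indicator measurableSet_Iic, integral_exp_mul_Iic hA]
  have hgi : Integrable g := integrable_exp_neg_mul_sq hb
  have hg : ∫ s, g s = √(π / (A / (2 * r))) := integral_gaussian _
  have hf0n : ∀ s, 0 ≤ f0 s := fun s => indicator_nonneg (fun _ _ => (Real.exp_pos _).le) s
  have hfn : ∀ i s, 0 ≤ f i s := by
    intro i
    refine Fin.cases ?_ ?_ i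
    · exact hf0n
    · intro j s; exact (Real.exp_pos _).le
  have hfi : Integrable (fun w : Fin (k + 1) → ℝ => ∏ i, f i (w i)) := by
    apply Integrable.fintype_prod
    intro i
    refine Fin.cases ?_ ?_ i
    · exact hf0i
    · intro j; exact hgi
  have hfint : ∫ w : Fin (k + 1) → ℝ, ∏ i, f i (w i) =
      (Real.exp (A * r) / A) * √(π / (A / (2 * r))) ^ k := by
    rw [integral_fintype_prod_volume_eq_prod, Fin.prod_univ_succ]
    simp only [f, Fin.cons_zero, Fin.cons_succ, hf0, hg]
    simp
  have key : ∀ w : Fin (k + 1) → ℝ, ENNReal.ofReal (Real.exp (2 * dotp a (φ w))) *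
      ENNReal.ofReal (r - ‖φ w‖) ^ m ≤
      ENNReal.ofReal (m.factorial * (A⁻¹) ^ m * Real.exp (A * r)) *
        ENNReal.ofReal (∏ i, f i (w i)) := by
    intro w
    obtain ⟨h1, h2⟩ := hw w
    rw [h2]
    by_cases hz : ‖φ w‖ < r
    · rw [← ENNReal.ofReal_pow (by linarith),
        ← ENNReal.ofReal_mul (by positivity), ← ENNReal.ofReal_mul (by positivity)]
      apply ENNReal.ofReal_le_ofReal
      set N := ‖φ w‖
      set s := w 0 with hs
      set V := ∑ i : Fin k, w i.succ ^ 2 with hV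
      have hV0 : 0 ≤ V := Finset.sum_nonneg fun i _ => sq_nonneg _
      have hN : 0 ≤ N := norm_nonneg _
      have hsN : s ≤ N := by nlinarith
      have hprod : ∏ i, f i (w i) = Real.exp (A * s - A / (2 * r) * V) := by
        rw [Fin.prod_univ_succ]
        simp only [f, Fin.cons_zero, Fin.cons_succ]
        simp only [f0, g]
        rw [indicator_of_mem (by simp only [mem_Iic]; linarith), ← Real.exp_sum, ← Real.exp_add,
          ← Finset.mul_sum]
        congr 1
        ring
      have hVle : V / (2 * r) ≤ N - s := by
        rw [div_le_iff₀ (by positivity)]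
        nlinarith
      have hpow : (r - N) ^ m ≤ m.factorial * (A⁻¹) ^ m * Real.exp (A * (r - N)) := by
        have h := Real.pow_div_factorial_le_exp (x := A * (r - N))
          (mul_nonneg hA.le (by linarith)) m
        rw [div_le_iff₀ (by positivity), mul_pow] at h
        rw [inv_pow]
        have hAm : 0 < A ^ m := by positivity
        calc (r - N) ^ m = (A ^ m * (r - N) ^ m) * (A ^ m)⁻¹ := by field_simp
          _ ≤ (Real.exp (A * (r - N)) * m.factorial) * (A ^ m)⁻¹ := by gcongr
          _ = _ := by ring
      rw [hprod]
      calc _ ≤ Real.exp (2 * (A * s)) * (m.factorial * (A⁻¹) ^ m * Real.exp (A * (r - N))) := by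
            gcongr
        _ = m.factorial * (A⁻¹) ^ m * Real.exp (2 * (A * s) + A * (r - N)) := by
            rw [Real.exp_add]; ring
        _ ≤ m.factorial * (A⁻¹) ^ m * Real.exp (A * r + (A * s - A / (2 * r) * V)) := by
            refine mul_le_mul_of_nonneg_left (Real.exp_le_exp.2 ?_) (by positivity)
            have : A * (V / (2 * r)) ≤ A * (N - s) := by gcongr
            have e : A / (2 * r) * V = A * (V / (2 * r)) := by ring
            rw [e]; linarith
        _ = _ := by rw [Real.exp_add (A * r)]; ring
    · rw [ENNReal.ofReal_of_nonpos (by linarith : r - ‖φ w‖ ≤ 0), zero_pow (by omega)]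
      simp
  calc _ ≤ _ := lintegral_mono key
    _ = ENNReal.ofReal (m.factorial * (A⁻¹) ^ m * Real.exp (A * r)) *
        ENNReal.ofReal (∫ w : Fin (k + 1) → ℝ, ∏ i, f i (w i)) := by
      rw [lintegral_const_mul' _ _ ENNReal.ofReal_ne_top, ofReal_integral_eq_lintegral_ofReal hfi]
      exact Filter.Eventually.of_forall fun w => Finset.prod_nonneg fun i _ => hfn i _
    _ = _ := by
      rw [hfint, ← ENNReal.ofReal_mul (by positivity)]

lemma redI_large_lower (k m : ℕ) (a : EuclideanSpace ℝ (Fin (k + 1))) (ha : a ≠ 0)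
    (r : ℝ) (hr : 0 < r) (har : 1 ≤ ‖a‖ * r) :
    ENNReal.ofReal (Real.exp (2 * (‖a‖ * r) - 1) * (3 / (16 * ‖a‖)) ^ m *
      ((1 / (4 * ‖a‖)) * (2 * √(r / (16 * (k + 1) * ‖a‖))) ^ k)) ≤ redI (k + 1) m a r := by
  obtain ⟨φ, hφ, hw⟩ := exists_coords k a ha
  rw [redI_coords k m a r φ hφ]
  have hA : 0 < ‖a‖ := norm_pos_iff.2 ha
  set A := ‖a‖ with hAdef
  set q := √(r / (16 * (k + 1) * A)) with hq
  have hq2 : q ^ 2 = r / (16 * (k + 1) * A) := Real.sq_sqrt (by positivity)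
  have hq0 : 0 ≤ q := Real.sqrt_nonneg _
  let l : Fin (k + 1) → ℝ := Fin.cons (r - 1 / (2 * A)) (fun _ => -q)
  let u : Fin (k + 1) → ℝ := Fin.cons (r - 1 / (4 * A)) (fun _ => q)
  have hvol : volume (Icc l u) = ENNReal.ofReal ((1 / (4 * A)) * (2 * q) ^ k) := by
    rw [Real.volume_Icc_pi, Fin.prod_univ_succ]
    simp only [l, u, Fin.cons_zero, Fin.cons_succ, Finset.prod_const, Finset.card_univ,
      Fintype.card_fin]
    rw [← ENNReal.ofReal_pow (by linarith), ← ENNReal.ofReal_mul]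
    · congr 1
      rw [sub_neg_eq_add, ← two_mul]
      congr 1
      field_simp; ring
    · have : 1 / (4 * A) ≤ 1 / (2 * A) := by gcongr; norm_num
      linarith
  have key : ∀ w : Fin (k + 1) → ℝ,
      (Icc l u).indicator (fun _ => ENNReal.ofReal
        (Real.exp (2 * (A * r) - 1) * (3 / (16 * A)) ^ m)) w ≤
      ENNReal.ofReal (Real.exp (2 * dotp a (φ w))) * ENNReal.ofReal (r - ‖φ w‖) ^ m := by
    intro w
    obtain ⟨h1, h2⟩ := hw w
    by_cases hz : w ∈ Icc l u
    · rw [indicator_of_mem hz]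
      have hs1 : r - 1 / (2 * A) ≤ w 0 := hz.1 0
      have hs2 : w 0 ≤ r - 1 / (4 * A) := hz.2 0
      have hv1 : ∀ i : Fin k, -q ≤ w i.succ := fun i => hz.1 i.succ
      have hv2 : ∀ i : Fin k, w i.succ ≤ q := fun i => hz.2 i.succ
      have hV : ∑ i : Fin k, w i.succ ^ 2 ≤ r / (16 * A) := by
        calc _ ≤ ∑ i : Fin k, q ^ 2 := by
              apply Finset.sum_le_sum
              intro i _
              exact sq_le_sq' (hv1 i) (hv2 i)
          _ = k * (r / (16 * (k + 1) * A)) := by rw [hq2]; simp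
          _ = (k / (k + 1)) * (r / (16 * A)) := by field_simp
          _ ≤ 1 * (r / (16 * A)) := by
              gcongr
              rw [div_le_one (by positivity)]; linarith
          _ = _ := one_mul _
      set δ := 1 / A with hδ
      have hδ0 : 0 < δ := by positivity
      have hδr : δ ≤ r := by rw [hδ, div_le_iff₀ hA]; linarith
      have e1 : 1 / (2 * A) = δ / 2 := by rw [hδ]; field_simp
      have e2 : 1 / (4 * A) = δ / 4 := by rw [hδ]; field_simp
      have e3 : r / (16 * A) = r * δ / 16 := by rw [hδ]; field_simp
      have e4 : 3 / (16 * A) = 3 * δ / 16 := by rw [hδ]; field_simp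
      rw [e1] at hs1; rw [e2] at hs2; rw [e3] at hV
      have hNorm : ‖φ w‖ ≤ r - 3 * δ / 16 := by
        apply le_of_sq_le_sq _ (by linarith)
        rw [h1]
        have : w 0 ^ 2 ≤ (r - δ / 4) ^ 2 := by
          apply pow_le_pow_left₀ _ hs2
          linarith
        nlinarith
      rw [← ENNReal.ofReal_pow (by linarith),
        ← ENNReal.ofReal_mul (by positivity)]
      apply ENNReal.ofReal_le_ofReal
      rw [h2, e4]
      gcongr
      · have : A * (r - δ / 2) ≤ A * w 0 := by gcongr
        have hAd : A * δ = 1 := by rw [hδ]; field_simp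
        nlinarith
      · linarith
    · rw [indicator_of_notMem hz]
      simp
  calc _ = ENNReal.ofReal (Real.exp (2 * (A * r) - 1) * (3 / (16 * A)) ^ m) * volume (Icc l u) := by
        rw [hvol, ← ENNReal.ofReal_mul (by positivity)]
    _ = _ := (lintegral_indicator_const measurableSet_Icc _).symm
    _ ≤ _ := lintegral_mono key

/-- Model sets sandwiching the Grushin balls. -/
def modelSet {n m : ℕ} (x : Ep n m) (r K : ℝ) : Set (Ep n m) :=
  {y | ‖y.2 - x.2‖ < K * (r - ‖y.1 - x.1‖)}

lemma muG_modelSet {n m : ℕ} (hm : 1 ≤ m) (a : EuclideanSpace ℝ (Fin n)) (x : Ep n m) (r K : ℝ)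
    (hK : 0 ≤ K) :
    muG a (modelSet x r K) =
      ENNReal.ofReal (omg m * K ^ m * Real.exp (2 * dotp a x.1)) * redI n m a r := by
  have hS : MeasurableSet (modelSet x r K) := by
    apply IsOpen.measurableSet
    exact isOpen_lt (by fun_prop) (by fun_prop)
  have hg : Measurable fun y : Ep n m => ENNReal.ofReal (Real.exp (2 * dotp a y.1)) := by
    simp only [dotp_eq_inner]; fun_prop
  unfold muG
  rw [withDensity_apply _ hS, ← lintegral_indicator hS, Measure.volume_eq_prod,
    lintegral_prod _ (hg.indicator hS).aemeasurable]
  have h1 : ∀ y : EuclideanSpace ℝ (Fin n),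
      ∫⁻ v : EuclideanSpace ℝ (Fin m), (modelSet x r K).indicator
        (fun y : Ep n m => ENNReal.ofReal (Real.exp (2 * dotp a y.1))) (y, v) =
      ENNReal.ofReal (Real.exp (2 * dotp a y)) *
        (ENNReal.ofReal (K * (r - ‖y - x.1‖)) ^ m * ENNReal.ofReal (omg m)) := by
    intro y
    rw [← vol_ball m hm x.2, ← lintegral_indicator_const measurableSet_ball]
    apply lintegral_congr
    intro v
    by_cases hv : ‖v - x.2‖ < K * (r - ‖y - x.1‖)
    · rw [indicator_of_mem (show (y, v) ∈ modelSet x r K from hv),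
        indicator_of_mem (by rwa [Metric.mem_ball, dist_eq_norm])]
    · rw [indicator_of_notMem (show (y, v) ∉ modelSet x r K from hv),
        indicator_of_notMem (by rwa [Metric.mem_ball, dist_eq_norm])]
  simp_rw [h1]
  rw [← lintegral_add_right_eq_self _ x.1]
  unfold redI
  rw [← lintegral_const_mul' _ _ ENNReal.ofReal_ne_top]
  apply lintegral_congr
  intro z
  have hd : dotp a (z + x.1) = dotp a z + dotp a x.1 := by
    simp only [dotp_eq_inner, inner_add_right]
  rw [hd, add_sub_cancel_right, ENNReal.ofReal_mul hK, mul_pow, mul_add, Real.exp_add,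
    ENNReal.ofReal_mul (by positivity), ENNReal.ofReal_mul (by have := omg_pos m; positivity),
    ENNReal.ofReal_mul (omg_pos m).le, ENNReal.ofReal_pow hK]
  ring

lemma modelSet_subset {n m : ℕ} (x : Ep n m) (r : ℝ) (hr : 0 < r) :
    modelSet x r ((r + ‖x.1‖) / 4) ⊆ grushinBall x r := by
  intro y hy
  have hy : ‖y.2 - x.2‖ < (r + ‖x.1‖) / 4 * (r - ‖y.1 - x.1‖) := hy
  show ‖x.1 - y.1‖ + _ < r
  rw [norm_sub_rev x.1, norm_sub_rev x.2]
  have ht := norm_nonneg (y.2 - x.2)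
  have hz := norm_nonneg (y.1 - x.1)
  have hx := norm_nonneg x.1
  have hy' := norm_nonneg y.1
  have htri := norm_sub_le y.1 x.1
  have hρ : 0 < r - ‖y.1 - x.1‖ := by
    by_contra hcon
    nlinarith
  split_ifs with h
  · have : ‖y.2 - x.2‖ / (‖x.1‖ + ‖y.1‖) < r - ‖y.1 - x.1‖ := by
      rcases (add_nonneg hx hy').eq_or_lt with h0 | h0
      · rw [← h0]; simpa using hρ
      rw [div_lt_iff₀ h0]
      rw [Real.sqrt_le_left h0.le] at h
      by_cases hc : r - ‖y.1 - x.1‖ ≤ ‖x.1‖ + ‖y.1‖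
      · nlinarith
      · nlinarith
    linarith
  · push Not at h
    have : √‖y.2 - x.2‖ < r - ‖y.1 - x.1‖ := by
      rw [Real.sqrt_lt' hρ]
      have h' : (‖x.1‖ + ‖y.1‖) ^ 2 < ‖y.2 - x.2‖ := (Real.lt_sqrt (by positivity)).1 h
      by_cases hc : r - ‖y.1 - x.1‖ ≤ ‖x.1‖ + ‖y.1‖
      · nlinarith
      · nlinarith
    linarith

lemma subset_modelSet {n m : ℕ} (x : Ep n m) (r : ℝ) (hr : 0 < r) :
    grushinBall x r ⊆ modelSet x r (2 * (r + ‖x.1‖)) := by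
  intro y hy
  have hy : ‖x.1 - y.1‖ + (if Real.sqrt ‖x.2 - y.2‖ ≤ ‖x.1‖ + ‖y.1‖
    then ‖x.2 - y.2‖ / (‖x.1‖ + ‖y.1‖) else Real.sqrt ‖x.2 - y.2‖) < r := hy
  show ‖y.2 - x.2‖ < 2 * (r + ‖x.1‖) * (r - ‖y.1 - x.1‖)
  rw [norm_sub_rev x.1, norm_sub_rev x.2] at hy
  have ht := norm_nonneg (y.2 - x.2)
  have hz := norm_nonneg (y.1 - x.1)
  have hx := norm_nonneg x.1
  have hy' := norm_nonneg y.1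
  have htri : ‖y.1‖ ≤ ‖y.1 - x.1‖ + ‖x.1‖ := by
    simpa using norm_add_le (y.1 - x.1) x.1
  split_ifs at hy with h
  · have hq : 0 ≤ ‖y.2 - x.2‖ / (‖x.1‖ + ‖y.1‖) := by positivity
    have hρ : 0 < r - ‖y.1 - x.1‖ := by linarith
    rcases (add_nonneg hx hy').eq_or_lt with h0 | h0
    · rw [← h0, Real.sqrt_le_left le_rfl] at h
      have : 0 < 2 * (r + ‖x.1‖) * (r - ‖y.1 - x.1‖) := by positivity
      linarith
    · have h3 : ‖y.2 - x.2‖ / (‖x.1‖ + ‖y.1‖) < r - ‖y.1 - x.1‖ := by linarith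
      rw [div_lt_iff₀ h0] at h3
      nlinarith
  · have hρ : √‖y.2 - x.2‖ < r - ‖y.1 - x.1‖ := by linarith
    have hs := Real.sqrt_nonneg ‖y.2 - x.2‖
    have hsq := Real.sq_sqrt ht
    nlinarith

lemma rpow_aux1 (k m : ℕ) (A : ℝ) (hA : 0 < A) :
    A ^ (-((((k + 1 : ℕ) : ℝ) + 1) / 2) - (m : ℝ)) = (A⁻¹) ^ m * A⁻¹ * (√A ^ k)⁻¹ := by
  have e : (-((((k + 1 : ℕ) : ℝ) + 1) / 2) - (m : ℝ)) = -(m : ℝ) + -1 + -((1 / 2) * (k : ℝ)) := by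
    push_cast; ring
  rw [e, Real.rpow_add hA, Real.rpow_add hA, Real.rpow_neg hA.le, Real.rpow_neg hA.le,
    Real.rpow_neg hA.le, Real.rpow_mul hA.le, Real.rpow_natCast, Real.rpow_natCast, Real.rpow_one,
    ← Real.sqrt_eq_rpow, inv_pow]

lemma rpow_aux2 (k : ℕ) (r : ℝ) (hr : 0 < r) :
    r ^ ((((k + 1 : ℕ) : ℝ) - 1) / 2) = √r ^ k := by
  have e : ((((k + 1 : ℕ) : ℝ) - 1) / 2) = (1 / 2) * (k : ℝ) := by push_cast; ring
  rw [e, Real.rpow_mul hr.le, Real.rpow_natCast, ← Real.sqrt_eq_rpow]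

/-- **Theorem (volume of Grushin balls for `μ_a`)**: there are constants `0 < c ≤ C`,
depending only on `n` and `m`, such that for every nonzero `a`, every `x` and every `r > 0`:
if `r ≤ 1/|a|` then `μ_a(B(x,r)) ≍ e^{2a·x'} r^{n+m} (r+|x'|)^m`, and if `r > 1/|a|` then
`μ_a(B(x,r)) ≍ |a|^{-(n+1)/2-m} e^{2(a·x'+|a|r)} r^{(n-1)/2} (r+|x'|)^m`. -/
theorem muG_grushinBall_asymptotics (n m : ℕ) (hn : 1 ≤ n) (hm : 1 ≤ m) :
    ∃ c C : ℝ, 0 < c ∧ c ≤ C ∧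
      ∀ a : EuclideanSpace ℝ (Fin n), a ≠ 0 → ∀ x : Ep n m, ∀ r : ℝ, 0 < r →
        (r ≤ 1 / ‖a‖ →
          ENNReal.ofReal
              (c * Real.exp (2 * dotp a x.1) * r ^ (n + m) * (r + ‖x.1‖) ^ m) ≤
            muG a (grushinBall x r) ∧
          muG a (grushinBall x r) ≤
            ENNReal.ofReal
              (C * Real.exp (2 * dotp a x.1) * r ^ (n + m) * (r + ‖x.1‖) ^ m)) ∧
        (1 / ‖a‖ < r →
          ENNReal.ofReal
              (c * ‖a‖ ^ (-(((n : ℝ) + 1) / 2) - (m : ℝ)) *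
                Real.exp (2 * (dotp a x.1 + ‖a‖ * r)) *
                  r ^ (((n : ℝ) - 1) / 2) * (r + ‖x.1‖) ^ m) ≤
            muG a (grushinBall x r) ∧
          muG a (grushinBall x r) ≤
            ENNReal.ofReal
              (C * ‖a‖ ^ (-(((n : ℝ) + 1) / 2) - (m : ℝ)) *
                Real.exp (2 * (dotp a x.1 + ‖a‖ * r)) *
                  r ^ (((n : ℝ) - 1) / 2) * (r + ‖x.1‖) ^ m)) := by
  obtain ⟨k, rfl⟩ : ∃ k, n = k + 1 := ⟨n - 1, by omega⟩
  set c1 := omg m * (1 / 4) ^ m * (Real.exp (-1) * (1 / 2) ^ (k + 1 + m) * omg (k + 1)) with hc1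
  set C1 := omg m * 2 ^ m * (Real.exp 2 * omg (k + 1)) with hC1
  set c2 := omg m * (1 / 4) ^ m * (Real.exp (-1) * (3 / 16) ^ m *
    ((1 / 4) * (2 * √(1 / (16 * ((k : ℝ) + 1)))) ^ k)) with hc2
  set C2 := omg m * 2 ^ m * (m.factorial * √(2 * π) ^ k) with hC2
  have ho := omg_pos m
  have ho' := omg_pos (k + 1)
  have p1 : 0 < c1 := by positivity
  have p2 : 0 < c2 := by positivity
  have P1 : 0 < C1 := by positivity
  have P2 : 0 < C2 := by positivity
  refine ⟨min c1 c2, max (min c1 c2) (max C1 C2), lt_min p1 p2, le_max_left _ _, ?_⟩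
  have hm1 : min c1 c2 ≤ c1 := min_le_left _ _
  have hm2 : min c1 c2 ≤ c2 := min_le_right _ _
  have hM1 : C1 ≤ max (min c1 c2) (max C1 C2) := le_max_of_le_right (le_max_left _ _)
  have hM2 : C2 ≤ max (min c1 c2) (max C1 C2) := le_max_of_le_right (le_max_right _ _)
  generalize min c1 c2 = c at *
  generalize max c (max C1 C2) = C at *
  intro a ha x r hr
  have hA : 0 < ‖a‖ := norm_pos_iff.2 ha
  have hx := norm_nonneg x.1
  have hlow := measure_mono (μ := muG a) (modelSet_subset x r hr)
  have hup := measure_mono (μ := muG a) (subset_modelSet x r hr)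
  rw [muG_modelSet hm a x r _ (by positivity)] at hlow hup
  set A := ‖a‖ with hAdef
  set X := r + ‖x.1‖ with hX
  have hX0 : 0 < X := by positivity
  refine ⟨fun h => ⟨?_, ?_⟩, fun h => ⟨?_, ?_⟩⟩
  · have h' : A * r ≤ 1 := by rwa [le_div_iff₀' hA] at h
    refine le_trans ?_ (le_trans (mul_le_mul_right (redI_small_lower (k + 1) m hn a r hr h') _) hlow)
    rw [← ENNReal.ofReal_mul (by positivity)]
    apply ENNReal.ofReal_le_ofReal
    calc _ ≤ c1 * Real.exp (2 * dotp a x.1) * r ^ (k + 1 + m) * X ^ m := by gcongr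
      _ = _ := by rw [hc1]; simp only [div_pow, one_pow]; field_simp
  · have h' : A * r ≤ 1 := by rwa [le_div_iff₀' hA] at h
    refine le_trans (le_trans hup
      (mul_le_mul_right (redI_small_upper (k + 1) m hn hm a r hr h') _)) ?_
    rw [← ENNReal.ofReal_mul (by positivity)]
    apply ENNReal.ofReal_le_ofReal
    calc _ = C1 * Real.exp (2 * dotp a x.1) * r ^ (k + 1 + m) * X ^ m := by
          rw [hC1, mul_pow]; ring
      _ ≤ _ := by gcongr
  · have h' : 1 ≤ A * r := by rw [div_lt_iff₀' hA] at h; exact h.le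
    refine le_trans ?_ (le_trans (mul_le_mul_right (redI_large_lower k m a ha r hr h') _) hlow)
    rw [← ENNReal.ofReal_mul (by positivity)]
    apply ENNReal.ofReal_le_ofReal
    rw [rpow_aux1 k m A hA, rpow_aux2 k r hr]
    have hsA : 0 < √A := Real.sqrt_pos.2 hA
    have hs : √(r / (16 * ((k : ℝ) + 1) * A)) = √(1 / (16 * ((k : ℝ) + 1))) * √r / √A := by
      rw [← Real.sqrt_mul (by positivity), ← Real.sqrt_div (by positivity)]
      congr 1; field_simp
    calc _ ≤ c2 * ((A⁻¹) ^ m * A⁻¹ * (√A ^ k)⁻¹) * Real.exp (2 * (dotp a x.1 + A * r)) *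
            √r ^ k * X ^ m := by gcongr
      _ = _ := by
        rw [hc2, ← hAdef, hs]
        generalize √(1 / (16 * ((k : ℝ) + 1))) = Q
        rw [mul_add 2 (dotp a x.1), Real.exp_add, sub_eq_add_neg, Real.exp_add]
        simp only [div_pow, mul_pow, one_pow, inv_pow]
        field_simp
  · refine le_trans (le_trans hup
      (mul_le_mul_right (redI_large_upper k m hm a ha r hr) _)) ?_
    rw [← ENNReal.ofReal_mul (by positivity)]
    apply ENNReal.ofReal_le_ofReal
    rw [rpow_aux1 k m A hA, rpow_aux2 k r hr]
    have hsA : 0 < √A := Real.sqrt_pos.2 hA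
    have hs : √(π / (A / (2 * r))) = √(2 * π) * √r / √A := by
      rw [← Real.sqrt_mul (by positivity), ← Real.sqrt_div (by positivity)]
      congr 1; field_simp
    calc _ = C2 * ((A⁻¹) ^ m * A⁻¹ * (√A ^ k)⁻¹) * Real.exp (2 * (dotp a x.1 + A * r)) *
            √r ^ k * X ^ m := by
          rw [hC2, ← hAdef, hs]
          generalize √(2 * π) = Q
          rw [mul_add 2 (dotp a x.1), Real.exp_add, two_mul (A * r), Real.exp_add]
          simp only [div_pow, mul_pow, inv_pow]
          field_simp
      _ ≤ _ := by gcongr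
end
end
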